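/- Fix n ≥ 2 and r ≥ 1, and let w : Fin r → {1,…,n−1} × {over, under} be any word in the braid generators and their inverses. For each j ∈ {0,…,r−1} with w(j) = (k, over) set a_j = α_{k+1} and b_j = α_k + 3^{2k+1}, and with w(j) = (k, under) set a_j = α_{k+1} and b_j = α_k + 3^{2k−1}, where α_k = Σ_{i=0}^{k−2} 9^i. Let N = 2r·3^{2n−1} and define d_w : ℤ → ℕ by: d_w(t) = 3^{2k−1} + (b_j − a_j) if t ≡ a_j + 2j·3^{2n−1} (mod N) for some j with w(j) having index k; d_w(t) = 3^{2k+1} − (b_j − a_j) if t ≡ b_j + 2j·3^{2n−1} (mod N) for some such j; and otherwise d_w(t) = 3^{2m−1} if t ≡ α_m (mod 3^{2m−1}) for some m ∈ {1,…,n}, and d_w(t) = 0 if no such m exists. Then the map I^w_n : ℤ → ℤ, I^w_n(t) = t + d_w(t), is a bijection of ℤ; i.e., I^w_n is a valid juggling pattern. -/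

import Mathlib

/-- `jugAlpha k = Σ_{j=0}^{k-2} 9^j` is the first throw time of the `k`-th
ball in the trivial juggling pattern. -/
def jugAlpha (k : ℕ) : ℕ := ∑ j ∈ Finset.range (k - 1), 9 ^ j

theorem jugAlpha_succ {k : ℕ} (hk : 1 ≤ k) : jugAlpha (k + 1) = jugAlpha k + 9 ^ (k - 1) := by
  obtain ⟨k, rfl⟩ := Nat.exists_eq_add_of_le' hk
  simp [jugAlpha, Finset.sum_range_succ]

theorem jugAlpha_lt (k : ℕ) : jugAlpha k < 9 ^ (k - 1) := by
  unfold jugAlpha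
  induction k - 1 with
  | zero => simp
  | succ k ih => rw [Finset.sum_range_succ, pow_succ]; omega

theorem three_pow_two_mul_sub_one {k : ℕ} (hk : 1 ≤ k) : 3 ^ (2 * k - 1) = 3 * 9 ^ (k - 1) := by
  obtain ⟨k, rfl⟩ := Nat.exists_eq_add_of_le' hk
  rw [show 2 * (k + 1) - 1 = 2 * k + 1 by omega, pow_succ, pow_mul]
  norm_num [mul_comm]

theorem three_pow_two_mul_add_one {k : ℕ} (hk : 1 ≤ k) : 3 ^ (2 * k + 1) = 27 * 9 ^ (k - 1) := by
  have h := three_pow_two_mul_sub_one (Nat.le_add_left 1 k)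
  rw [show 2 * (k + 1) - 1 = 2 * k + 1 by omega] at h
  obtain ⟨k, rfl⟩ := Nat.exists_eq_add_of_le' hk
  rw [h, Nat.add_sub_cancel, Nat.add_sub_cancel, pow_succ]
  ring

/-- All later first throw times agree modulo three times the next power of nine. -/
theorem jugAlpha_modEq {m l : ℕ} (hm : 1 ≤ m) (hml : m < l) :
    jugAlpha l ≡ jugAlpha m + 9 ^ (m - 1) [MOD 3 ^ (2 * m - 1)] := by
  induction l, hml using Nat.le_induction with
  | base => rw [jugAlpha_succ hm]
  | succ l hl ih =>
    rw [jugAlpha_succ (by omega)]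
    have h : 3 ^ (2 * m - 1) ∣ 9 ^ (l - 1) := by
      rw [show (9 : ℕ) = 3 ^ 2 by norm_num, ← pow_mul]
      exact pow_dvd_pow 3 (by omega)
    simpa using ih.add ((Nat.modEq_zero_iff_dvd).2 h)

theorem jugAlpha_classes_disjoint {m l : ℕ} (hm : 1 ≤ m) (hml : m < l) {t : ℤ}
    (h₁ : t ≡ (jugAlpha m : ℤ) [ZMOD (3 : ℤ) ^ (2 * m - 1)])
    (h₂ : t ≡ (jugAlpha l : ℤ) [ZMOD (3 : ℤ) ^ (2 * l - 1)]) : False := by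
  have h₃ : t ≡ (jugAlpha l : ℤ) [ZMOD (3 : ℤ) ^ (2 * m - 1)] :=
    h₂.of_dvd (pow_dvd_pow 3 (by omega))
  have h₄ : (jugAlpha m + 0 : ℕ) ≡ jugAlpha m + 9 ^ (m - 1) [MOD 3 ^ (2 * m - 1)] := by
    refine Nat.ModEq.trans ?_ (jugAlpha_modEq hm hml)
    rw [← Int.natCast_modEq_iff]
    simpa using h₁.symm.trans h₃
  have h₅ := (Nat.modEq_zero_iff_dvd).1 (Nat.ModEq.add_left_cancel' _ h₄).symm
  rw [three_pow_two_mul_sub_one hm] at h₅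
  have h₆ := Nat.le_of_dvd (by positivity) h₅
  have : 0 < 9 ^ (m - 1) := by positivity
  omega

theorem jugAlpha_class_unique {m l : ℕ} (hm : 1 ≤ m) (hl : 1 ≤ l) {t : ℤ}
    (h₁ : t ≡ (jugAlpha m : ℤ) [ZMOD (3 : ℤ) ^ (2 * m - 1)])
    (h₂ : t ≡ (jugAlpha l : ℤ) [ZMOD (3 : ℤ) ^ (2 * l - 1)]) : m = l := by
  rcases lt_trichotomy m l with h | h | h
  · exact (jugAlpha_classes_disjoint hm h h₁ h₂).elim
  · exact h
  · exact (jugAlpha_classes_disjoint hl h h₂ h₁).elim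

/-- The trivial pattern exists as a bijection of the integers. -/
theorem exists_trivial_pattern (n : ℕ) : ∃ g : ℤ → ℤ, Function.Bijective g ∧
    (∀ t m, 1 ≤ m → m ≤ n → t ≡ (jugAlpha m : ℤ) [ZMOD (3 : ℤ) ^ (2 * m - 1)] →
      g t = t + 3 ^ (2 * m - 1)) ∧
    (∀ t, (∀ m, 1 ≤ m → m ≤ n → ¬ t ≡ (jugAlpha m : ℤ) [ZMOD (3 : ℤ) ^ (2 * m - 1)]) →
      g t = t) := by
  classical
  let P : ℤ → ℕ → Prop := fun t m =>
    1 ≤ m ∧ m ≤ n ∧ t ≡ (jugAlpha m : ℤ) [ZMOD (3 : ℤ) ^ (2 * m - 1)]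
  let D : ℤ → ℤ := fun t => if h : ∃ m, P t m then 3 ^ (2 * h.choose - 1) else 0
  have hD : ∀ t m, P t m → D t = 3 ^ (2 * m - 1) := by
    intro t m h
    have h' : ∃ m, P t m := ⟨m, h⟩
    have h₂ := h'.choose_spec
    simp only [D, dif_pos h', jugAlpha_class_unique h₂.1 h.1 h₂.2.2 h.2.2]
  have hD0 : ∀ t, (¬ ∃ m, P t m) → D t = 0 := fun t h => dif_neg h
  have hadd : ∀ t, D (t + D t) = D t := by
    intro t
    by_cases h : ∃ m, P t m
    · obtain ⟨m, hm⟩ := h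
      rw [hD t m hm]
      exact hD _ m ⟨hm.1, hm.2.1, by simpa [Int.ModEq] using hm.2.2⟩
    · simp [hD0 t h]
  have hsub : ∀ t, D (t - D t) = D t := by
    intro t
    by_cases h : ∃ m, P t m
    · obtain ⟨m, hm⟩ := h
      rw [hD t m hm]
      exact hD _ m ⟨hm.1, hm.2.1, by simpa [Int.ModEq] using hm.2.2⟩
    · simp [hD0 t h]
  refine ⟨fun t => t + D t, ?_, ?_, ?_⟩
  · refine Function.bijective_iff_has_inverse.2 ⟨fun t => t - D t, fun t => ?_, fun t => ?_⟩
    · simp [hadd]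
    · simp [hsub]
  · intro t m h₁ h₂ h₃
    simp only [hD t m ⟨h₁, h₂, h₃⟩]
  · intro t h
    have h0 := hD0 t (by rintro ⟨m, h₁, h₂, h₃⟩; exact h m h₁ h₂ h₃)
    simp only [h0, add_zero]

theorem chamber_position_unique {r : ℕ} {L x y t : ℤ} (hx : 0 ≤ x) (hxL : x < L) (hy : 0 ≤ y)
    (hyL : y < L) {i j : Fin r} (h₁ : t ≡ x + (i : ℕ) * L [ZMOD (r : ℤ) * L])
    (h₂ : t ≡ y + (j : ℕ) * L [ZMOD (r : ℤ) * L]) : i = j ∧ x = y := by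
  have hlt : ∀ (z : ℤ) (k : Fin r), z < L → z + (k : ℕ) * L < r * L := by
    intro z k hz
    have hk : ((k : ℕ) : ℤ) + 1 ≤ r := by exact_mod_cast k.2
    nlinarith
  have hL : 0 < L := by omega
  have h := h₁.symm.trans h₂
  rw [Int.ModEq, Int.emod_eq_of_lt (by positivity) (hlt x i hxL),
    Int.emod_eq_of_lt (by positivity) (hlt y j hyL)] at h
  have hxy : x = y := by
    have hmod : (x + (i : ℕ) * L) % L = (y + (j : ℕ) * L) % L := by rw [h]
    rwa [Int.add_mul_emod_self_right, Int.add_mul_emod_self_right, Int.emod_eq_of_lt hx hxL,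
      Int.emod_eq_of_lt hy hyL] at hmod
  refine ⟨?_, hxy⟩
  rw [hxy, add_right_inj] at h
  exact Fin.ext (by exact_mod_cast mul_right_cancel₀ hL.ne' h)

/-- Exchanging, in each of `r` consecutive chambers of length `L` and periodically, the two
positions `p j` and `q j` is an involution of the integers. -/
theorem exists_chamber_swap {r : ℕ} {L : ℤ} (p q : Fin r → ℤ)
    (hp : ∀ j, 0 ≤ p j ∧ p j < L) (hq : ∀ j, 0 ≤ q j ∧ q j < L) (hpq : ∀ i, p i ≠ q i) :
    ∃ s : ℤ → ℤ, Function.Involutive s ∧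
      (∀ t j, t ≡ p j + (j : ℕ) * L [ZMOD (r : ℤ) * L] → s t = t + (q j - p j)) ∧
      (∀ t j, t ≡ q j + (j : ℕ) * L [ZMOD (r : ℤ) * L] → s t = t - (q j - p j)) ∧
      (∀ t, (∀ j, ¬ t ≡ p j + (j : ℕ) * L [ZMOD (r : ℤ) * L] ∧
        ¬ t ≡ q j + (j : ℕ) * L [ZMOD (r : ℤ) * L]) → s t = t) := by
  classical
  let P : ℤ → Fin r → Prop := fun t j => t ≡ p j + (j : ℕ) * L [ZMOD (r : ℤ) * L]
  let Q : ℤ → Fin r → Prop := fun t j => t ≡ q j + (j : ℕ) * L [ZMOD (r : ℤ) * L]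
  let s : ℤ → ℤ := fun t =>
    if h : ∃ j, P t j then t + (q h.choose - p h.choose)
    else if h : ∃ j, Q t j then t - (q h.choose - p h.choose) else t
  have hsP : ∀ t j, P t j → s t = t + (q j - p j) := by
    intro t j h
    have h' : ∃ j, P t j := ⟨j, h⟩
    have e := (chamber_position_unique (hp _).1 (hp _).2 (hp _).1 (hp _).2 h'.choose_spec h).1
    simp only [s, dif_pos h', e]
  have hsQ : ∀ t j, Q t j → s t = t - (q j - p j) := by
    intro t j h
    have h' : ∃ j, Q t j := ⟨j, h⟩
    have hn : ¬ ∃ j, P t j := by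
      rintro ⟨i, hi⟩
      obtain ⟨rfl, e⟩ := chamber_position_unique (hp _).1 (hp _).2 (hq _).1 (hq _).2 hi h
      exact hpq _ e
    have e := (chamber_position_unique (hq _).1 (hq _).2 (hq _).1 (hq _).2 h'.choose_spec h).1
    simp only [s, dif_neg hn, dif_pos h', e]
  have hs0 : ∀ t, (∀ j, ¬ P t j ∧ ¬ Q t j) → s t = t := by
    intro t h
    have hP : ¬ ∃ j, P t j := fun ⟨j, hj⟩ => (h j).1 hj
    have hQ : ¬ ∃ j, Q t j := fun ⟨j, hj⟩ => (h j).2 hj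
    simp only [s, dif_neg hP, dif_neg hQ]
  refine ⟨s, fun t => ?_, hsP, hsQ, hs0⟩
  by_cases h : ∃ j, P t j ∨ Q t j
  · obtain ⟨j, hj | hj⟩ := h
    · have : Q (t + (q j - p j)) j := by
        have := Int.ModEq.add_right (q j - p j) hj
        rwa [show p j + (j : ℕ) * L + (q j - p j) = q j + (j : ℕ) * L by ring] at this
      rw [hsP t j hj, hsQ _ j this]
      ring
    · have : P (t - (q j - p j)) j := by
        have := Int.ModEq.sub_right (q j - p j) hj
        rwa [show q j + (j : ℕ) * L - (q j - p j) = p j + (j : ℕ) * L by ring] at this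
      rw [hsQ t j hj, hsP _ j this]
      ring
  · have h0 := hs0 t (fun j => ⟨fun hj => h ⟨j, .inl hj⟩, fun hj => h ⟨j, .inr hj⟩⟩)
    rw [h0, h0]

/-- For any word `w` of length `r` in the braid generators `σ_k` and their
inverses (encoded as pairs `(k, over?)` with `1 ≤ k ≤ n−1`, `true` = over),
the pattern `I^w_n`, obtained by concatenating `r` fundamental chambers of the
trivial pattern `I_n` and performing in the `j`-th chamber the site swap at
positions `a_j = α_{k+1}` and `b_j = α_k + 3^{2k+1}` (over-crossing) or
`b_j = α_k + 3^{2k−1}` (under-crossing), is a bijection of `ℤ`, i.e. a valid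
juggling pattern.  Here `N = 2r·3^{2n−1}` is the period. -/
theorem word_pattern_bijective (n r : ℕ) (hn : 2 ≤ n) (hr : 1 ≤ r)
    (w : Fin r → ℕ × Bool) (hw : ∀ j : Fin r, 1 ≤ (w j).1 ∧ (w j).1 ≤ n - 1)
    (a b : Fin r → ℕ)
    (ha : ∀ j : Fin r, a j = jugAlpha ((w j).1 + 1))
    (hb : ∀ j : Fin r, b j = jugAlpha (w j).1 +
      (if (w j).2 then 3 ^ (2 * (w j).1 + 1) else 3 ^ (2 * (w j).1 - 1)))
    (N : ℕ) (hN : N = 2 * r * 3 ^ (2 * n - 1))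
    (d : ℤ → ℕ)
    (hda : ∀ (t : ℤ) (j : Fin r),
      t ≡ ((a j : ℤ) + 2 * (j : ℕ) * 3 ^ (2 * n - 1)) [ZMOD (N : ℤ)] →
      d t = 3 ^ (2 * (w j).1 - 1) + (b j - a j))
    (hdb : ∀ (t : ℤ) (j : Fin r),
      t ≡ ((b j : ℤ) + 2 * (j : ℕ) * 3 ^ (2 * n - 1)) [ZMOD (N : ℤ)] →
      d t = 3 ^ (2 * (w j).1 + 1) - (b j - a j))
    (hdo : ∀ t : ℤ,
      (∀ j : Fin r,
        ¬ t ≡ ((a j : ℤ) + 2 * (j : ℕ) * 3 ^ (2 * n - 1)) [ZMOD (N : ℤ)] ∧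
        ¬ t ≡ ((b j : ℤ) + 2 * (j : ℕ) * 3 ^ (2 * n - 1)) [ZMOD (N : ℤ)]) →
      ∀ m : ℕ, 1 ≤ m → m ≤ n →
        t ≡ (jugAlpha m : ℤ) [ZMOD (3 : ℤ) ^ (2 * m - 1)] → d t = 3 ^ (2 * m - 1))
    (hd0 : ∀ t : ℤ,
      (∀ j : Fin r,
        ¬ t ≡ ((a j : ℤ) + 2 * (j : ℕ) * 3 ^ (2 * n - 1)) [ZMOD (N : ℤ)] ∧
        ¬ t ≡ ((b j : ℤ) + 2 * (j : ℕ) * 3 ^ (2 * n - 1)) [ZMOD (N : ℤ)]) →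
      (∀ m : ℕ, 1 ≤ m → m ≤ n →
        ¬ t ≡ (jugAlpha m : ℤ) [ZMOD (3 : ℤ) ^ (2 * m - 1)]) → d t = 0) :
    Function.Bijective (fun t : ℤ => t + (d t : ℤ)) := by
  have hposn : 3 ^ (2 * n - 1) = 3 * 9 ^ (n - 1) := three_pow_two_mul_sub_one (by omega)
  have hbounds : ∀ j, a j < b j ∧ b j - a j ≤ 3 ^ (2 * (w j).1 + 1) ∧
      b j < 2 * 3 ^ (2 * n - 1) := by
    intro j
    obtain ⟨hk, hkn⟩ := hw j
    have h₁ := jugAlpha_lt (w j).1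
    have h₂ : 27 * 9 ^ ((w j).1 - 1) ≤ 3 * 9 ^ (n - 1) := by
      rw [← hposn, ← three_pow_two_mul_add_one hk]
      exact Nat.pow_le_pow_right (by norm_num) (by omega)
    rw [ha, hb, jugAlpha_succ hk, hposn, three_pow_two_mul_add_one hk,
      three_pow_two_mul_sub_one hk]
    split_ifs <;> omega
  obtain ⟨g, hg, hgm, hg0⟩ := exists_trivial_pattern n
  obtain ⟨s, hs, hsa, hsb, hs0⟩ := exists_chamber_swap (L := 2 * 3 ^ (2 * n - 1))
    (fun j => (a j : ℤ)) (fun j => (b j : ℤ))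
    (fun j => ⟨by positivity, by have := hbounds j; exact_mod_cast (by omega :
      a j < 2 * 3 ^ (2 * n - 1))⟩)
    (fun j => ⟨by positivity, by exact_mod_cast (hbounds j).2.2⟩)
    (fun j => by have := (hbounds j).1; simp only [ne_eq, Nat.cast_inj]; omega)
  have hN' : (N : ℤ) = (r : ℤ) * (2 * 3 ^ (2 * n - 1)) := by rw [hN]; push_cast; ring
  have hoff : ∀ j : Fin r, (2 * (j : ℕ) * 3 ^ (2 * n - 1) : ℤ) =
      (j : ℕ) * (2 * 3 ^ (2 * n - 1)) := fun j => by ring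
  simp only [hN', hoff] at hda hdb hdo hd0
  have hclass : ∀ (t x : ℤ) (j : Fin r) (m : ℕ), m ≤ n →
      t ≡ x + (j : ℕ) * (2 * 3 ^ (2 * n - 1)) [ZMOD (r : ℤ) * (2 * 3 ^ (2 * n - 1))] →
      t ≡ x [ZMOD (3 : ℤ) ^ (2 * m - 1)] := by
    intro t x j m hm h
    have hdvd : (3 : ℤ) ^ (2 * m - 1) ∣ 3 ^ (2 * n - 1) := pow_dvd_pow 3 (by omega)
    refine (h.of_dvd ((hdvd.mul_left 2).mul_left _)).trans ?_
    simpa using (Int.modEq_zero_iff_dvd.2 ((hdvd.mul_left 2).mul_left ((j : ℕ) : ℤ))).add_left x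
  have haclass : ∀ (t : ℤ) (j : Fin r),
      t ≡ (a j : ℤ) + (j : ℕ) * (2 * 3 ^ (2 * n - 1)) [ZMOD (r : ℤ) * (2 * 3 ^ (2 * n - 1))] →
      g t = t + 3 ^ (2 * (w j).1 + 1) := by
    intro t j h
    have hk := hw j
    have := hclass t _ j ((w j).1 + 1) (by omega) h
    rw [ha] at this
    exact hgm t _ (by omega) (by omega) this
  have hbclass : ∀ (t : ℤ) (j : Fin r),
      t ≡ (b j : ℤ) + (j : ℕ) * (2 * 3 ^ (2 * n - 1)) [ZMOD (r : ℤ) * (2 * 3 ^ (2 * n - 1))] →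
      g t = t + 3 ^ (2 * (w j).1 - 1) := by
    intro t j h
    have hk := hw j
    refine hgm t _ hk.1 (by omega) ((hclass t _ j (w j).1 (by omega) h).trans ?_)
    have hdvd : (3 : ℤ) ^ (2 * (w j).1 - 1) ∣
        ((if (w j).2 then 3 ^ (2 * (w j).1 + 1) else 3 ^ (2 * (w j).1 - 1) : ℕ) : ℤ) := by
      split_ifs <;> push_cast <;> exact pow_dvd_pow 3 (by omega)
    rw [hb]
    push_cast at hdvd ⊢
    simpa using (Int.modEq_zero_iff_dvd.2 hdvd).add_left (jugAlpha (w j).1 : ℤ)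
  have hfg : (fun t : ℤ => t + (d t : ℤ)) = g ∘ s := by
    funext t
    simp only [Function.comp_apply]
    by_cases hA : ∃ j : Fin r, t ≡ (a j : ℤ) + (j : ℕ) * (2 * 3 ^ (2 * n - 1))
        [ZMOD (r : ℤ) * (2 * 3 ^ (2 * n - 1))]
    · obtain ⟨j, hj⟩ := hA
      have h := hj.add_right ((b j : ℤ) - a j)
      rw [add_right_comm, add_sub_cancel] at h
      rw [hsa t j hj, hbclass _ j h, hda t j hj]
      push_cast [(hbounds j).1.le]
      ring
    by_cases hB : ∃ j : Fin r, t ≡ (b j : ℤ) + (j : ℕ) * (2 * 3 ^ (2 * n - 1))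
        [ZMOD (r : ℤ) * (2 * 3 ^ (2 * n - 1))]
    · obtain ⟨j, hj⟩ := hB
      have h := hj.sub_right ((b j : ℤ) - a j)
      rw [add_sub_right_comm, sub_sub_cancel] at h
      rw [hsb t j hj, haclass _ j h, hdb t j hj]
      push_cast [(hbounds j).1.le, (hbounds j).2.1]
      ring
    have hne := fun j => And.intro (fun hj => hA ⟨j, hj⟩) (fun hj => hB ⟨j, hj⟩)
    rw [hs0 t hne]
    by_cases hm : ∃ m, 1 ≤ m ∧ m ≤ n ∧ t ≡ (jugAlpha m : ℤ) [ZMOD (3 : ℤ) ^ (2 * m - 1)]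
    · obtain ⟨m, h₁, h₂, h₃⟩ := hm
      rw [hgm t m h₁ h₂ h₃, hdo t hne m h₁ h₂ h₃]
      push_cast
      rfl
    · have hm' := fun m h₁ h₂ h₃ => hm ⟨m, h₁, h₂, h₃⟩
      rw [hg0 t hm', hd0 t hne hm']
      simp
  rw [hfg]
  exact hg.comp hs.bijective
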